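/- Let E be a real Banach space, let a < b be real numbers, and let w : ℝ → E be continuously differentiable on [a, b]. Then ‖w(b) − (1/(b − a)) ∫_a^b w(s) ds‖² ≤ ((b − a)/3) ∫_a^b ‖w′(s)‖² ds. -/

import Mathlib

open intervalIntegral

/-- The Cauchy–Schwarz inequality for interval integrals of continuous functions. -/
theorem intervalIntegral_mul_sq_le {a b : ℝ} (hab : a ≤ b) {f g : ℝ → ℝ}
    (hf : ContinuousOn f (Set.Icc a b)) (hg : ContinuousOn g (Set.Icc a b)) :
    (∫ s in a..b, f s * g s) ^ 2 ≤ (∫ s in a..b, f s ^ 2) * ∫ s in a..b, g s ^ 2 := by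
  have hff : IntervalIntegrable (fun s => f s ^ 2) MeasureTheory.volume a b :=
    (hf.pow 2).intervalIntegrable_of_Icc hab
  have hgg : IntervalIntegrable (fun s => g s ^ 2) MeasureTheory.volume a b :=
    (hg.pow 2).intervalIntegrable_of_Icc hab
  have hfg : IntervalIntegrable (fun s => f s * g s) MeasureTheory.volume a b :=
    (hf.mul hg).intervalIntegrable_of_Icc hab
  have key : ∀ t : ℝ, 0 ≤ (∫ s in a..b, f s ^ 2) * (t * t) +
      (2 * ∫ s in a..b, f s * g s) * t + ∫ s in a..b, g s ^ 2 := by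
    intro t
    have hnonneg : 0 ≤ ∫ s in a..b, (t * f s + g s) ^ 2 :=
      integral_nonneg hab fun s _ => sq_nonneg _
    have hexpand : ∫ s in a..b, (t * f s + g s) ^ 2 =
        ∫ s in a..b, (t * t) * f s ^ 2 + (2 * t) * (f s * g s) + g s ^ 2 :=
      integral_congr fun s _ => by ring
    rw [hexpand, integral_add ((hff.const_mul _).add (hfg.const_mul _)) hgg,
      integral_add (hff.const_mul _) (hfg.const_mul _), integral_const_mul,
      integral_const_mul] at hnonneg
    linarith
  have hdiscrim := discrim_le_zero key
  rw [discrim] at hdiscrim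
  linarith

/-- The kernel representation of the deviation of the right-endpoint value from the average. -/
theorem endpoint_sub_average_eq {E : Type*} [NormedAddCommGroup E] [NormedSpace ℝ E]
    [CompleteSpace E] {a b : ℝ} (hab : a < b) {w w' : ℝ → E}
    (hw : ∀ s ∈ Set.Icc a b, HasDerivWithinAt w (w' s) (Set.Icc a b) s)
    (hint : IntervalIntegrable w' MeasureTheory.volume a b) :
    w b - (b - a)⁻¹ • ∫ s in a..b, w s = (b - a)⁻¹ • ∫ s in a..b, (s - a) • w' s := by
  rw [← Set.uIcc_of_le hab.le] at hw
  have hparts := integral_smul_deriv_eq_deriv_smul_of_hasDerivWithinAt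
    (u := fun s => s - a) (u' := fun _ => 1)
    (fun s _ => ((hasDerivAt_id s).sub_const a).hasDerivWithinAt) hw
    intervalIntegrable_const hint
  simp only [sub_self, zero_smul, sub_zero, one_smul] at hparts
  rw [hparts, smul_sub, inv_smul_smul₀ (sub_pos.2 hab).ne']

/-- Bound used for estimates (tt11), (tt12), (tt13), (tt16) of Lemma 4.3: for `w`
continuously differentiable on `[a,b]`,
`‖w(b) − (1/(b−a)) ∫_a^b w(s) ds‖² ≤ ((b−a)/3) ∫_a^b ‖w′(s)‖² ds`. -/
theorem stmt11 {E : Type*} [NormedAddCommGroup E] [NormedSpace ℝ E] [CompleteSpace E]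
    (a b : ℝ) (hab : a < b) (w w' : ℝ → E)
    (hw : ∀ s ∈ Set.Icc a b, HasDerivWithinAt w (w' s) (Set.Icc a b) s)
    (hcont : ContinuousOn w' (Set.Icc a b)) :
    ‖w b - (b - a)⁻¹ • ∫ s in a..b, w s‖ ^ 2 ≤
      (b - a) / 3 * ∫ s in a..b, ‖w' s‖ ^ 2 := by
  have hpos : 0 < b - a := sub_pos.2 hab
  rw [endpoint_sub_average_eq hab hw (hcont.intervalIntegrable_of_Icc hab.le), norm_smul,
    norm_inv, Real.norm_of_nonneg hpos.le, mul_pow]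
  have hnorm : ‖∫ s in a..b, (s - a) • w' s‖ ≤ ∫ s in a..b, (s - a) * ‖w' s‖ := by
    refine (norm_integral_le_integral_norm hab.le).trans_eq (integral_congr fun s hs => ?_)
    rw [Set.uIcc_of_le hab.le] at hs
    simp only [norm_smul, Real.norm_of_nonneg (sub_nonneg.2 hs.1)]
  have hkernel : ∫ s in a..b, (s - a) ^ 2 = (b - a) ^ 3 / 3 := by
    rw [integral_comp_sub_right (fun s => s ^ 2), integral_pow]
    norm_num
  have hcs := intervalIntegral_mul_sq_le hab.le
    (f := fun s => s - a) (by fun_prop) hcont.norm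
  rw [hkernel] at hcs
  calc (b - a)⁻¹ ^ 2 * ‖∫ s in a..b, (s - a) • w' s‖ ^ 2
      ≤ (b - a)⁻¹ ^ 2 * ((b - a) ^ 3 / 3 * ∫ s in a..b, ‖w' s‖ ^ 2) := by
        gcongr
        exact (pow_le_pow_left₀ (norm_nonneg _) hnorm 2).trans hcs
    _ = (b - a) / 3 * ∫ s in a..b, ‖w' s‖ ^ 2 := by
        field_simp
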